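/- The kernel of the leading Hessian block matrix has dimension at least r(r+1)/2: let n ≥ 2, r ≥ 1, let Z ∈ ℝ^{n×r} have rows z_iᵀ with Zᵀ1_n = 0 and rank(Z) = r, let h_i = (z_iᵀ,1)ᵀ, let c_ij = c_ji ∈ ℝ for i ≠ j, and define H_L blockwise by [H_L]_{ii} = Σ_{j≠i} c_ij h_j h_jᵀ and [H_L]_{ij} = c_ij h_j h_iᵀ (i ≠ j). Then the linear map sending a pair (W, v), with W ∈ ℝ^{r×r} skew-symmetric and v ∈ ℝ^r, to the vector u with node blocks u_i = ((W z_i + v)ᵀ, −z_iᵀ v)ᵀ is injective, its image is contained in the kernel of H_L, and hence dim ker H_L ≥ r(r−1)/2 + r = r(r+1)/2. -/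

import Mathlib

open scoped BigOperators Matrix

noncomputable section

/-- the leading Hessian block matrix `H_L`: diagonal blocks `Σ_{j≠i} c_ij h_j h_jᵀ`,
off-diagonal blocks `c_ij h_j h_iᵀ`. -/
def HLmat (n r : ℕ) (h : Fin n → Fin (r + 1) → ℝ) (c : Fin n → Fin n → ℝ) :
    Matrix (Fin n × Fin (r + 1)) (Fin n × Fin (r + 1)) ℝ :=
  Matrix.of fun p q =>
    if p.1 = q.1 then
      ∑ j ∈ Finset.univ.filter (· ≠ p.1), c p.1 j * h j p.2 * h j q.2
    else c p.1 q.1 * h q.1 p.2 * h p.1 q.2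

/-- `h_i = (z_iᵀ,1)ᵀ`. -/
def hvec {r : ℕ} (z : Fin r → ℝ) : Fin (r + 1) → ℝ := Fin.snoc z 1

/-- the node block `u_i = ((W z_i + v)ᵀ, −z_iᵀv)ᵀ`. -/
def uvec {r : ℕ} (z : Fin r → ℝ) (W : Matrix (Fin r) (Fin r) ℝ) (v : Fin r → ℝ) :
    Fin (r + 1) → ℝ := Fin.snoc (W.mulVec z + v) (-(z ⬝ᵥ v))

/-- the symmetry direction with node blocks `u_i = ((W z_i + v)ᵀ, −z_iᵀv)ᵀ`. -/
def symDir (n r : ℕ) (z : Fin n → Fin r → ℝ) (W : Matrix (Fin r) (Fin r) ℝ)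
    (v : Fin r → ℝ) : Fin n × Fin (r + 1) → ℝ :=
  fun p => uvec (z p.1) W v p.2

lemma HLmat_mulVec_apply (n r : ℕ) (h : Fin n → Fin (r + 1) → ℝ) (c : Fin n → Fin n → ℝ)
    (u : Fin n × Fin (r + 1) → ℝ) (i : Fin n) (a : Fin (r + 1)) :
    (HLmat n r h c *ᵥ u) (i, a) =
      ∑ j ∈ Finset.univ.filter (· ≠ i),
        c i j * h j a * (h j ⬝ᵥ (fun b => u (i, b)) + h i ⬝ᵥ (fun b => u (j, b))) := by
  have hdiag : ∑ b, HLmat n r h c (i, a) (i, b) * u (i, b) =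
      ∑ j ∈ Finset.univ.filter (· ≠ i), c i j * h j a * (h j ⬝ᵥ (fun b => u (i, b))) := by
    simp only [HLmat, Matrix.of_apply, if_true, dotProduct, Finset.sum_mul, Finset.mul_sum]
    rw [Finset.sum_comm]
    simp only [mul_assoc]
  have hoff : ∀ j ∈ Finset.univ.filter (· ≠ i),
      ∑ b, HLmat n r h c (i, a) (j, b) * u (j, b) =
        c i j * h j a * (h i ⬝ᵥ (fun b => u (j, b))) := by
    intro j hj
    have hij : i ≠ j := fun e => (Finset.mem_filter.mp hj).2 e.symm
    simp [HLmat, hij, dotProduct, Finset.mul_sum, mul_assoc]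
  have hsplit : (HLmat n r h c *ᵥ u) (i, a) =
      ∑ j, ∑ b, HLmat n r h c (i, a) (j, b) * u (j, b) := by
    rw [Matrix.mulVec, dotProduct, Fintype.sum_prod_type]
  rw [hsplit, ← Finset.sum_filter_add_sum_filter_not Finset.univ (· ≠ i),
    Finset.sum_congr rfl hoff]
  simp only [ne_eq, not_not, Finset.filter_eq', Finset.mem_univ, if_true, Finset.sum_singleton]
  rw [hdiag, ← Finset.sum_add_distrib]
  exact Finset.sum_congr rfl fun j _ => by ring

lemma hvec_dotProduct_uvec {r : ℕ} (x y : Fin r → ℝ) (W : Matrix (Fin r) (Fin r) ℝ)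
    (v : Fin r → ℝ) :
    hvec x ⬝ᵥ uvec y W v = x ⬝ᵥ (W *ᵥ y) + x ⬝ᵥ v - y ⬝ᵥ v := by
  rw [← dotProduct_add, sub_eq_add_neg]
  simp [hvec, uvec, dotProduct, Fin.sum_univ_castSucc]

lemma dotProduct_mulVec_add_swap_of_skew {r : ℕ} {W : Matrix (Fin r) (Fin r) ℝ}
    (hW : Wᵀ = -W) (x y : Fin r → ℝ) : x ⬝ᵥ (W *ᵥ y) + y ⬝ᵥ (W *ᵥ x) = 0 := by
  rw [dotProduct_comm y, Matrix.dotProduct_mulVec, ← Matrix.mulVec_transpose, hW,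
    Matrix.neg_mulVec, neg_dotProduct, neg_add_cancel]

lemma symDir_mem_ker (n r : ℕ) (z : Fin n → Fin r → ℝ) (c : Fin n → Fin n → ℝ)
    {W : Matrix (Fin r) (Fin r) ℝ} (hW : Wᵀ = -W) (v : Fin r → ℝ) :
    symDir n r z W v ∈ LinearMap.ker
      (Matrix.mulVecLin (HLmat n r (fun i => hvec (z i)) c)) := by
  rw [LinearMap.mem_ker, Matrix.mulVecLin_apply]
  ext ⟨i, a⟩
  rw [HLmat_mulVec_apply, Pi.zero_apply]
  refine Finset.sum_eq_zero fun j _ => mul_eq_zero_of_right _ ?_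
  change hvec (z j) ⬝ᵥ uvec (z i) W v + hvec (z i) ⬝ᵥ uvec (z j) W v = 0
  rw [hvec_dotProduct_uvec, hvec_dotProduct_uvec]
  linarith [dotProduct_mulVec_add_swap_of_skew hW (z j) (z i)]

lemma mulVec_injective_of_rank_eq {n r : ℕ} {A : Matrix (Fin n) (Fin r) ℝ}
    (hA : A.rank = r) : Function.Injective A.mulVec := by
  have h := LinearMap.finrank_range_add_finrank_ker A.mulVecLin
  rw [← Matrix.rank, hA, Module.finrank_fin_fun] at h
  have hker : LinearMap.ker A.mulVecLin = ⊥ := Submodule.finrank_eq_zero.mp (by omega)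
  exact LinearMap.ker_eq_bot.mp hker

lemma symDir_injective {n r : ℕ} (hn : n ≠ 0) {z : Fin n → Fin r → ℝ}
    (hcenter : ∀ k, ∑ i, z i k = 0)
    (hrank : (Matrix.of z : Matrix (Fin n) (Fin r) ℝ).rank = r)
    {W₁ W₂ : Matrix (Fin r) (Fin r) ℝ} {v₁ v₂ : Fin r → ℝ}
    (h : symDir n r z W₁ v₁ = symDir n r z W₂ v₂) : W₁ = W₂ ∧ v₁ = v₂ := by
  have hblock : ∀ i k, (W₁ *ᵥ z i) k + v₁ k = (W₂ *ᵥ z i) k + v₂ k := fun i k => by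
    simpa [symDir, uvec] using congrFun h (i, k.castSucc)
  have hsum : ∀ (W : Matrix (Fin r) (Fin r) ℝ) k, ∑ i, (W *ᵥ z i) k = 0 := fun W k => by
    simp only [Matrix.mulVec, dotProduct]
    rw [Finset.sum_comm]
    simp [← Finset.mul_sum, hcenter]
  have hv : v₁ = v₂ := by
    ext k
    have hk := Finset.sum_congr rfl fun (i : Fin n) (_ : i ∈ Finset.univ) => hblock i k
    simpa [Finset.sum_add_distrib, hsum, hn] using hk
  refine ⟨?_, hv⟩
  subst hv
  funext k
  refine mulVec_injective_of_rank_eq hrank (funext fun i => ?_)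
  have hik := add_right_cancel (hblock i k)
  simpa [Matrix.mulVec, dotProduct_comm (z i)] using hik

/-- The skew-symmetric matrix whose strictly upper triangular entries are read off from `g`. -/
def skewOfSym2 (r : ℕ) (g : Sym2 (Fin r) → ℝ) : Matrix (Fin r) (Fin r) ℝ :=
  Matrix.of fun i j => if i < j then g s(i, j) else if j < i then -g s(i, j) else 0

lemma skewOfSym2_transpose (r : ℕ) (g : Sym2 (Fin r) → ℝ) :
    (skewOfSym2 r g)ᵀ = -skewOfSym2 r g := by
  ext i j
  rcases lt_trichotomy i j with hij | rfl | hij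
  · simp [skewOfSym2, hij, hij.not_gt, Sym2.eq_swap]
  · simp [skewOfSym2]
  · simp [skewOfSym2, hij, hij.not_gt, Sym2.eq_swap]

/-- The symmetry directions, linearly parametrized by functions on unordered pairs: off-diagonal
pairs give the entries of `W`, diagonal pairs those of `v`. -/
def symDirOfSym2 (n r : ℕ) (z : Fin n → Fin r → ℝ) :
    (Sym2 (Fin r) → ℝ) →ₗ[ℝ] (Fin n × Fin (r + 1) → ℝ) where
  toFun g := symDir n r z (skewOfSym2 r g) fun k => g s(k, k)
  map_add' f g := by
    have hW : skewOfSym2 r (f + g) = skewOfSym2 r f + skewOfSym2 r g := by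
      ext i j
      simp only [skewOfSym2, Matrix.of_apply, Matrix.add_apply, Pi.add_apply]
      split_ifs <;> ring
    ext ⟨i, a⟩
    refine Fin.lastCases ?_ (fun k => ?_) a
    · simp [symDir, uvec, dotProduct, mul_add, Finset.sum_add_distrib, add_comm]
    · simp [symDir, uvec, hW, Matrix.add_mulVec]
      ring
  map_smul' t g := by
    have hW : skewOfSym2 r (t • g) = t • skewOfSym2 r g := by
      ext i j
      simp only [skewOfSym2, Matrix.of_apply, Matrix.smul_apply, Pi.smul_apply, smul_eq_mul]
      split_ifs <;> ring
    ext ⟨i, a⟩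
    refine Fin.lastCases ?_ (fun k => ?_) a
    · simp [symDir, uvec, dotProduct, Finset.mul_sum, mul_left_comm]
    · simp [symDir, uvec, hW, Matrix.smul_mulVec, mul_add]

lemma symDirOfSym2_injective {n r : ℕ} (hn : n ≠ 0) {z : Fin n → Fin r → ℝ}
    (hcenter : ∀ k, ∑ i, z i k = 0)
    (hrank : (Matrix.of z : Matrix (Fin n) (Fin r) ℝ).rank = r) :
    Function.Injective (symDirOfSym2 n r z) := by
  intro f g hfg
  obtain ⟨hW, hv⟩ := symDir_injective hn hcenter hrank hfg
  have hlt : ∀ i j : Fin r, i < j → f s(i, j) = g s(i, j) := fun i j hij => by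
    simpa [skewOfSym2, hij] using congrFun (congrFun hW i) j
  ext p
  induction p using Sym2.ind with
  | _ i j =>
    rcases lt_trichotomy i j with hij | rfl | hij
    · exact hlt i j hij
    · exact congrFun hv i
    · rw [Sym2.eq_swap]
      exact hlt j i hij

lemma le_finrank_ker_HLmat {n r : ℕ} (hn : n ≠ 0) {z : Fin n → Fin r → ℝ}
    (hcenter : ∀ k, ∑ i, z i k = 0)
    (hrank : (Matrix.of z : Matrix (Fin n) (Fin r) ℝ).rank = r) (c : Fin n → Fin n → ℝ) :
    r * (r + 1) / 2 ≤ Module.finrank ℝ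
      ↥(LinearMap.ker (Matrix.mulVecLin (HLmat n r (fun i => hvec (z i)) c))) := by
  have hcard : Module.finrank ℝ (Sym2 (Fin r) → ℝ) = r * (r + 1) / 2 := by
    rw [Module.finrank_fintype_fun_eq_card, Sym2.card, Fintype.card_fin, Nat.choose_two_right,
      Nat.add_sub_cancel, mul_comm]
  rw [← hcard, ← LinearMap.finrank_range_of_inj (symDirOfSym2_injective hn hcenter hrank)]
  refine Submodule.finrank_mono ?_
  rintro _ ⟨g, rfl⟩
  exact symDir_mem_ker n r z c (skewOfSym2_transpose r g) _

/-- **The kernel of the leading Hessian block matrix has dimension at least `r(r+1)/2`.**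
If `Z` is centered with full column rank `r`, the linear map `(W, v) ↦ u` (with `W`
skew-symmetric) is injective, its image is contained in `ker H_L`, and hence
`dim ker H_L ≥ r(r−1)/2 + r = r(r+1)/2`. -/
theorem kernel_dimension_lower_bound (n r : ℕ) (hn : 2 ≤ n) (hr : 1 ≤ r)
    (z : Fin n → Fin r → ℝ)
    (hcenter : ∀ k, ∑ i, z i k = 0)
    (hrank : (Matrix.of z : Matrix (Fin n) (Fin r) ℝ).rank = r)
    (c : Fin n → Fin n → ℝ) (hsymm : ∀ i j, c i j = c j i) :
    (∀ (W₁ W₂ : Matrix (Fin r) (Fin r) ℝ) (v₁ v₂ : Fin r → ℝ),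
      W₁ᵀ = -W₁ → W₂ᵀ = -W₂ →
      symDir n r z W₁ v₁ = symDir n r z W₂ v₂ → W₁ = W₂ ∧ v₁ = v₂) ∧
    (∀ (W : Matrix (Fin r) (Fin r) ℝ) (v : Fin r → ℝ), Wᵀ = -W →
      symDir n r z W v ∈ LinearMap.ker
        (Matrix.mulVecLin (HLmat n r (fun i => hvec (z i)) c))) ∧
    r * (r + 1) / 2 ≤ Module.finrank ℝ
      ↥(LinearMap.ker (Matrix.mulVecLin (HLmat n r (fun i => hvec (z i)) c))) := by
  have hn' : n ≠ 0 := by omega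
  exact ⟨fun _ _ _ _ _ _ h => symDir_injective hn' hcenter hrank h,
    fun _ v hW => symDir_mem_ker n r z c hW v,
    le_finrank_ker_HLmat hn' hcenter hrank c⟩

end
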